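/- arXiv:1708.05786 — 6 statements merged into one kernel-verified Lean document; each statement's English description precedes it below -/
import Mathlib

section
/- Let n ≥ 2 be a natural number, let ε be a real number with 0 < ε ≤ 1, and let a : Fin n → ℝ satisfy 0 ≤ a i ≤ 1 for all i. Set K = ⌈2·log₂(n/ε)⌉ and, for each k ∈ {1,…,K}, let B_k = {i : 2^{−k} < a i ≤ 2^{−(k−1)}}. Then there exists k ∈ {1,…,K} such that ∑_{i ∈ B_k} a i ≥ (∑_i a i − ε²/n)/K, and moreover this bucket satisfies |B_k| ≥ 2^{k−1} · (∑_i a i − ε²/n)/K. -/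
open Finset

lemma exists_bucket (x : ℝ) (hx1 : x ≤ 1) (K : ℕ) (hK : (2:ℝ) ^ (-(K:ℤ)) < x) :
    ∃ k ∈ Finset.Icc 1 K, (2 : ℝ) ^ (-(k : ℤ)) < x ∧ x ≤ (2 : ℝ) ^ (-(k : ℤ) + 1) := by
  induction K with
  | zero => simp at hK; linarith
  | succ m ih =>
    by_cases h : (2:ℝ) ^ (-(m:ℤ)) < x
    · obtain ⟨k, hk, h2⟩ := ih h
      rw [Finset.mem_Icc] at hk
      exact ⟨k, Finset.mem_Icc.2 ⟨hk.1, by omega⟩, h2⟩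
    · refine ⟨m+1, Finset.mem_Icc.2 ⟨by omega, le_rfl⟩, hK, ?_⟩
      have e : (-((m+1 : ℕ):ℤ) + 1) = -(m:ℤ) := by push_cast; ring
      rw [e]
      exact not_lt.1 h

/-- Dyadic bucketing: with `K = ⌈2·log₂(n/ε)⌉` buckets
`B_k = {i : 2^{-k} < a i ≤ 2^{-(k-1)}}`, some bucket has total weight at least
`(∑ a i − ε²/n)/K`, and that bucket has at least `2^{k-1}·(∑ a i − ε²/n)/K` elements. -/
theorem dyadic_bucketing (n : ℕ) (hn : 2 ≤ n) (ε : ℝ) (hε0 : 0 < ε) (hε1 : ε ≤ 1)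
    (a : Fin n → ℝ) (ha : ∀ i, 0 ≤ a i ∧ a i ≤ 1) :
    ∃ k ∈ Finset.Icc 1 (⌈2 * Real.logb 2 ((n : ℝ) / ε)⌉₊),
      ((∑ i, a i) - ε ^ 2 / n) / (⌈2 * Real.logb 2 ((n : ℝ) / ε)⌉₊ : ℝ) ≤
        (∑ i ∈ univ.filter
          (fun i => (2 : ℝ) ^ (-(k : ℤ)) < a i ∧ a i ≤ (2 : ℝ) ^ (-(k : ℤ) + 1)), a i) ∧
      (2 : ℝ) ^ ((k : ℤ) - 1) *
          (((∑ i, a i) - ε ^ 2 / n) / (⌈2 * Real.logb 2 ((n : ℝ) / ε)⌉₊ : ℝ)) ≤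
        ((univ.filter
          (fun i => (2 : ℝ) ^ (-(k : ℤ)) < a i ∧ a i ≤ (2 : ℝ) ^ (-(k : ℤ) + 1))).card : ℝ) := by
  have hn0 : (0:ℝ) < n := by positivity
  have hn2 : (2:ℝ) ≤ n := by exact_mod_cast hn
  have hq : (1:ℝ) < n / ε := by rw [lt_div_iff₀ hε0]; linarith
  have hlog : 0 < Real.logb 2 ((n : ℝ) / ε) := Real.logb_pos (by norm_num) hq
  have hle := Nat.le_ceil (2 * Real.logb 2 ((n : ℝ) / ε))
  have hKpos : 0 < ⌈2 * Real.logb 2 ((n : ℝ) / ε)⌉₊ := Nat.ceil_pos.2 (by linarith)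
  generalize ⌈2 * Real.logb 2 ((n : ℝ) / ε)⌉₊ = K at hle hKpos ⊢
  have hKr : (0:ℝ) < K := by exact_mod_cast hKpos
  have hpow : ((n:ℝ) / ε) ^ 2 ≤ 2 ^ K := by
    have h1 : Real.logb 2 (((n:ℝ) / ε) ^ 2) ≤ K := by
      rw [Real.logb_pow]; exact_mod_cast hle
    rw [Real.logb_le_iff_le_rpow (by norm_num) (by positivity), Real.rpow_natCast] at h1
    exact h1
  have hsmall : (n:ℝ) * 2 ^ (-(K:ℤ)) ≤ ε ^ 2 / n := by
    rw [zpow_neg, zpow_natCast, ← div_eq_mul_inv, div_le_div_iff₀ (by positivity) hn0]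
    rw [div_pow, div_le_iff₀ (by positivity)] at hpow
    nlinarith
  set B : ℕ → Finset (Fin n) := fun k => univ.filter
    (fun i => (2 : ℝ) ^ (-(k : ℤ)) < a i ∧ a i ≤ (2 : ℝ) ^ (-(k : ℤ) + 1)) with hB
  have hpt : ∀ i, a i ≤ 2 ^ (-(K:ℤ)) + ∑ k ∈ Finset.Icc 1 K, if i ∈ B k then a i else 0 := by
    intro i
    have hnn : ∀ k ∈ Finset.Icc 1 K, (0:ℝ) ≤ if i ∈ B k then a i else 0 := by
      intro k _
      split_ifs
      · exact (ha i).1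
      · exact le_rfl
    have hp : (0:ℝ) < 2 ^ (-(K:ℤ)) := by positivity
    by_cases h : (2:ℝ) ^ (-(K:ℤ)) < a i
    · obtain ⟨k, hk, h2⟩ := exists_bucket (a i) (ha i).2 K h
      have h3 := Finset.single_le_sum hnn hk
      have h4 : i ∈ B k := by simp only [hB, Finset.mem_filter, Finset.mem_univ, true_and]; exact h2
      rw [if_pos h4] at h3
      linarith
    · have := Finset.sum_nonneg hnn
      linarith
  have htot : (∑ i, a i) - ε ^ 2 / n ≤ ∑ k ∈ Finset.Icc 1 K, ∑ i ∈ B k, a i := by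
    have h1 := Finset.sum_le_sum (fun i (_ : i ∈ (univ : Finset (Fin n))) => hpt i)
    rw [Finset.sum_add_distrib, Finset.sum_comm] at h1
    simp only [Finset.sum_const, Finset.card_univ, Fintype.card_fin, nsmul_eq_mul,
      Finset.sum_ite_mem, Finset.univ_inter] at h1
    linarith
  have hex : ∃ k ∈ Finset.Icc 1 K, ((∑ i, a i) - ε ^ 2 / n) / K ≤ ∑ i ∈ B k, a i := by
    by_contra! hcon
    have h1 := Finset.sum_lt_sum_of_nonempty (Finset.nonempty_Icc.2 hKpos) hcon
    rw [Finset.sum_const, Nat.card_Icc, nsmul_eq_mul, Nat.add_sub_cancel,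
      mul_div_cancel₀ _ hKr.ne'] at h1
    linarith
  obtain ⟨k, hk, h⟩ := hex
  refine ⟨k, hk, h, ?_⟩
  have hc : ∑ i ∈ B k, a i ≤ (B k).card * (2:ℝ) ^ (-(k : ℤ) + 1) := by
    rw [← nsmul_eq_mul]
    exact Finset.sum_le_card_nsmul _ _ _ (fun i hi => (Finset.mem_filter.1 hi).2.2)
  calc (2:ℝ) ^ ((k:ℤ) - 1) * (((∑ i, a i) - ε ^ 2 / n) / K)
      ≤ (2:ℝ) ^ ((k:ℤ) - 1) * ((B k).card * (2:ℝ) ^ (-(k : ℤ) + 1)) :=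
        mul_le_mul_of_nonneg_left (h.trans hc) (by positivity)
    _ = (B k).card * ((2:ℝ) ^ ((k:ℤ) - 1) * (2:ℝ) ^ (-(k : ℤ) + 1)) := by ring
    _ = (B k).card := by
        rw [← zpow_add₀ (by norm_num : (2:ℝ) ≠ 0)]
        simp
end

section
/- Let n and m be naturals with 1 ≤ m ≤ n, let I be a nonempty subset of Fin n, and set α = m·|I|/n (a positive real). Suppose that for every i ∈ I we are given a family 𝒥_i of m-element subsets of Fin n such that: every S ∈ 𝒥_i contains i and satisfies |S ∩ I| ≤ 4α, and |𝒥_i| ≥ (1/9)·C(n−1, m−1). For an m-element subset S of Fin n, let d(S) = |{i ∈ I : S ∈ 𝒥_i}|. Then the number of m-element subsets S of Fin n with α/10 ≤ d(S) ≤ 4α is at least C(n, m)/360. -/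
open Finset

/-- Combinatorial core of Lemma 3.3: if each `i ∈ I` has a family `𝒥 i` of
`m`-element subsets of `Fin n`, each containing `i` and meeting `I` in at most `4α`
elements (where `α = m·|I|/n`), with `|𝒥 i| ≥ (1/9)·C(n−1, m−1)`, then at least
`C(n,m)/360` of the `m`-element subsets `S` satisfy `α/10 ≤ d(S) ≤ 4α`, where
`d(S) = |{i ∈ I : S ∈ 𝒥 i}|`. -/
theorem informative_sets_core (n m : ℕ) (hm : 1 ≤ m) (hmn : m ≤ n)
    (I : Finset (Fin n)) (hI : I.Nonempty)
    (𝒥 : Fin n → Finset (Finset (Fin n)))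
    (h𝒥 : ∀ i ∈ I, ∀ S ∈ 𝒥 i, S.card = m ∧ i ∈ S ∧
      ((S ∩ I).card : ℝ) ≤ 4 * ((m : ℝ) * (I.card : ℝ) / (n : ℝ)))
    (hcard : ∀ i ∈ I, (1 / 9 : ℝ) * ((n - 1).choose (m - 1) : ℝ) ≤ ((𝒥 i).card : ℝ)) :
    ((n.choose m : ℝ)) / 360 ≤
      ((((Finset.univ : Finset (Fin n)).powersetCard m).filter
        (fun S => ((m : ℝ) * (I.card : ℝ) / (n : ℝ)) / 10 ≤
            ((I.filter (fun i => S ∈ 𝒥 i)).card : ℝ) ∧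
          ((I.filter (fun i => S ∈ 𝒥 i)).card : ℝ) ≤
            4 * ((m : ℝ) * (I.card : ℝ) / (n : ℝ)))).card : ℝ) := by
  have hn : 0 < n := by omega
  have hnR : (0 : ℝ) < n := by exact_mod_cast hn
  have hmR : (0 : ℝ) < m := by exact_mod_cast hm
  have hIR : (0 : ℝ) < I.card := by exact_mod_cast hI.card_pos
  have hchoose : (n : ℝ) * ((n - 1).choose (m - 1) : ℝ) = (n.choose m : ℝ) * m := by
    have h := Nat.add_one_mul_choose_eq (n - 1) (m - 1)
    rw [Nat.sub_add_cancel hn, Nat.sub_add_cancel hm] at h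
    exact_mod_cast h
  obtain ⟨α, hα⟩ : ∃ α : ℝ, α = (m : ℝ) * (I.card : ℝ) / (n : ℝ) := ⟨_, rfl⟩
  rw [← hα] at h𝒥 ⊢
  have hαpos : 0 < α := by rw [hα]; positivity
  have hd : ∀ S : Finset (Fin n), ((I.filter (fun i => S ∈ 𝒥 i)).card : ℝ) ≤ 4 * α := by
    intro S
    rcases (I.filter (fun i => S ∈ 𝒥 i)).eq_empty_or_nonempty with h | ⟨i, hi⟩
    · rw [h]; simp; positivity
    · rw [Finset.mem_filter] at hi
      refine le_trans ?_ (h𝒥 i hi.1 S hi.2).2.2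
      norm_cast
      apply Finset.card_le_card
      intro j hj
      rw [Finset.mem_filter] at hj
      exact Finset.mem_inter.2 ⟨(h𝒥 j hj.1 S hj.2).2.1, hj.1⟩
  have hdc : ∑ S ∈ (Finset.univ : Finset (Fin n)).powersetCard m,
      (I.filter (fun i => S ∈ 𝒥 i)).card = ∑ i ∈ I, (𝒥 i).card := by
    simp_rw [Finset.card_filter]
    rw [Finset.sum_comm]
    refine Finset.sum_congr rfl fun i hi => ?_
    rw [← Finset.card_filter]
    congr 1
    ext S
    simp only [Finset.mem_filter, Finset.mem_powersetCard, Finset.subset_univ, true_and]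
    exact ⟨fun h => h.2, fun h => ⟨(h𝒥 i hi S h).1, h⟩⟩
  have hlow : α * (n.choose m : ℝ) / 9 ≤ ∑ S ∈ (Finset.univ : Finset (Fin n)).powersetCard m,
      ((I.filter (fun i => S ∈ 𝒥 i)).card : ℝ) := by
    have h1 := Finset.sum_le_sum hcard
    rw [Finset.sum_const, nsmul_eq_mul] at h1
    have h2 : ∑ S ∈ (Finset.univ : Finset (Fin n)).powersetCard m,
      ((I.filter (fun i => S ∈ 𝒥 i)).card : ℝ) = ∑ i ∈ I, ((𝒥 i).card : ℝ) := by
      exact_mod_cast hdc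
    rw [h2]
    refine le_trans (le_of_eq ?_) h1
    rw [hα]
    field_simp
    linarith
  simp only [hd, and_true]
  have hup : ∑ S ∈ (Finset.univ : Finset (Fin n)).powersetCard m,
      ((I.filter (fun i => S ∈ 𝒥 i)).card : ℝ) ≤
      ∑ S ∈ (Finset.univ : Finset (Fin n)).powersetCard m,
        (α / 10 + 4 * α * (if α / 10 ≤ ((I.filter (fun i => S ∈ 𝒥 i)).card : ℝ)
          then (1 : ℝ) else 0)) := by
    refine Finset.sum_le_sum fun S _ => ?_
    split_ifs with h
    · linarith [hd S]
    · linarith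
  rw [Finset.sum_add_distrib, ← Finset.mul_sum, Finset.sum_boole, Finset.sum_const,
    Finset.card_powersetCard, Finset.card_univ, Fintype.card_fin, nsmul_eq_mul] at hup
  have h3 := hlow.trans hup
  refine le_of_mul_le_mul_left ?_ hαpos
  linarith
end

section
/- Let S be a finite set of size p ≥ 1, let q be a natural with 1 ≤ q ≤ p, let L ⊆ S be nonempty with |L| = λ, and set d = λ·q/p (a positive real). Suppose that for every i ∈ L we are given a family ℛ_i of q-element subsets of S such that: every T ∈ ℛ_i contains i and satisfies |T ∩ L| ≤ 4d, and |ℛ_i| ≥ (1/20)·C(p−1, q−1). For a q-element subset T of S, let g(T) = |{i ∈ L : T ∈ ℛ_i}|. Then the number of q-element subsets T of S with d/100 ≤ g(T) ≤ 4d is at least C(p, q)/100. -/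
open Finset

/-- Combinatorial core of Claim 3.5: if each `i ∈ L` has a family `ℛ i` of
`q`-element subsets of `S`, each containing `i` and meeting `L` in at most `4d`
elements (where `d = |L|·q/p`), with `|ℛ i| ≥ (1/20)·C(p−1, q−1)`, then at least
`C(p,q)/100` of the `q`-element subsets `T` of `S` satisfy `d/100 ≤ g(T) ≤ 4d`,
where `g(T) = |{i ∈ L : T ∈ ℛ i}|`. -/
theorem revealing_sets_core {α : Type*} [DecidableEq α] (S : Finset α) (p q : ℕ)
    (hp : S.card = p) (hp1 : 1 ≤ p) (hq1 : 1 ≤ q) (hqp : q ≤ p)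
    (L : Finset α) (hLS : L ⊆ S) (hL : L.Nonempty)
    (ℛ : α → Finset (Finset α))
    (hℛ : ∀ i ∈ L, ∀ T ∈ ℛ i, T ⊆ S ∧ T.card = q ∧ i ∈ T ∧
      ((T ∩ L).card : ℝ) ≤ 4 * ((L.card : ℝ) * (q : ℝ) / (p : ℝ)))
    (hcard : ∀ i ∈ L, (1 / 20 : ℝ) * ((p - 1).choose (q - 1) : ℝ) ≤ ((ℛ i).card : ℝ)) :
    ((p.choose q : ℝ)) / 100 ≤
      (((S.powersetCard q).filter
        (fun T => ((L.card : ℝ) * (q : ℝ) / (p : ℝ)) / 100 ≤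
            ((L.filter (fun i => T ∈ ℛ i)).card : ℝ) ∧
          ((L.filter (fun i => T ∈ ℛ i)).card : ℝ) ≤
            4 * ((L.card : ℝ) * (q : ℝ) / (p : ℝ)))).card : ℝ) := by
  classical
  set d : ℝ := (L.card : ℝ) * (q : ℝ) / (p : ℝ) with hd
  have hp0 : (0 : ℝ) < p := by exact_mod_cast hp1
  have hq0 : (0 : ℝ) < q := by exact_mod_cast hq1
  have hL0 : (0 : ℝ) < L.card := by exact_mod_cast hL.card_pos
  have hd0 : 0 < d := by positivity
  have hg : ∀ T, ((L.filter (fun i => T ∈ ℛ i)).card : ℝ) ≤ 4 * d := by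
    intro T
    rcases (L.filter (fun i => T ∈ ℛ i)).eq_empty_or_nonempty with h | ⟨i, hi⟩
    · rw [h]; simp; positivity
    · rw [mem_filter] at hi
      refine le_trans ?_ (hℛ i hi.1 T hi.2).2.2.2
      have : L.filter (fun i => T ∈ ℛ i) ⊆ T ∩ L := by
        intro j hj
        rw [mem_filter] at hj
        exact mem_inter.2 ⟨(hℛ j hj.1 T hj.2).2.2.1, hj.1⟩
      exact_mod_cast card_le_card this
  have hdc : ∑ T ∈ S.powersetCard q, ((L.filter (fun i => T ∈ ℛ i)).card : ℝ)
      = ∑ i ∈ L, ((ℛ i).card : ℝ) := by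
    have h1 := sum_card_bipartiteAbove_eq_sum_card_bipartiteBelow
      (s := S.powersetCard q) (t := L) (fun T i => T ∈ ℛ i)
    have h2 : ∀ i ∈ L, (bipartiteBelow (fun T i => T ∈ ℛ i) (S.powersetCard q) i) = ℛ i := by
      intro i hi
      ext T
      simp only [bipartiteBelow, mem_filter, mem_powersetCard]
      exact ⟨fun h => h.2, fun h => ⟨⟨(hℛ i hi T h).1, (hℛ i hi T h).2.1⟩, h⟩⟩
    have h3 := h1.trans (sum_congr rfl (fun i hi => congrArg Finset.card (h2 i hi)))
    simp only [bipartiteAbove] at h3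
    exact_mod_cast h3
  have hch : (p : ℝ) * ((p - 1).choose (q - 1) : ℝ) = (p.choose q : ℝ) * q := by
    obtain ⟨a, rfl⟩ : ∃ a, p = a + 1 := ⟨p - 1, by omega⟩
    obtain ⟨b, rfl⟩ : ∃ b, q = b + 1 := ⟨q - 1, by omega⟩
    have := Nat.add_one_mul_choose_eq a b
    simp only [Nat.add_sub_cancel]
    exact_mod_cast this
  have hlow : d * (p.choose q : ℝ) / 20 ≤ ∑ i ∈ L, ((ℛ i).card : ℝ) := by
    have h := card_nsmul_le_sum L (fun i => ((ℛ i).card : ℝ)) _ hcard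
    rw [nsmul_eq_mul] at h
    refine le_trans (le_of_eq ?_) h
    have : ((p - 1).choose (q - 1) : ℝ) = (p.choose q : ℝ) * q / p := by
      rw [eq_div_iff hp0.ne', ← hch]; ring
    rw [this, hd]; ring
  set P : Finset α → Prop := fun T => d / 100 ≤ ((L.filter (fun i => T ∈ ℛ i)).card : ℝ) ∧
    ((L.filter (fun i => T ∈ ℛ i)).card : ℝ) ≤ 4 * d with hP
  have hup : ∑ T ∈ S.powersetCard q, ((L.filter (fun i => T ∈ ℛ i)).card : ℝ)
      ≤ ∑ T ∈ S.powersetCard q, (4 * d * (if P T then 1 else 0) + d / 100) := by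
    refine sum_le_sum fun T _ => ?_
    by_cases h : P T
    · rw [if_pos h]; linarith [hg T]
    · rw [if_neg h]
      have : ¬ d / 100 ≤ ((L.filter (fun i => T ∈ ℛ i)).card : ℝ) := fun h' => h ⟨h', hg T⟩
      linarith
  rw [sum_add_distrib, ← mul_sum, sum_boole, sum_const, card_powersetCard, hp, nsmul_eq_mul,
    hdc] at hup
  have hfin := hlow.trans hup
  have key : d * ((p.choose q : ℝ) / 100) ≤ d * (((S.powersetCard q).filter P).card : ℝ) := by
    linarith
  convert le_of_mul_le_mul_left key hd0
end

section
/- Let n and m be naturals with 1 ≤ m ≤ n, let I be a nonempty subset of Fin n, let D ≥ 1 and c > 0 be reals. Suppose that for every i ∈ I we are given a family 𝒥_i of m-element subsets of Fin n such that: every S ∈ 𝒥_i contains i and satisfies |S ∩ I| ≤ D, and |𝒥_i| ≥ c·C(n−1, m−1). Then the number of m-element subsets S of Fin n that belong to 𝒥_i for at least one i ∈ I is at least |I|·c·C(n−1, m−1)/D. -/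
open Finset

/-- Combinatorial core of Case 2 / Claim 3.7: if each `i ∈ I` has a family `𝒥 i` of
`m`-element subsets of `Fin n`, each containing `i` and meeting `I` in at most `D`
elements, with `|𝒥 i| ≥ c·C(n−1, m−1)`, then the number of `m`-element subsets
belonging to some `𝒥 i` is at least `|I|·c·C(n−1, m−1)/D`. -/
theorem informative_union_count (n m : ℕ) (hm : 1 ≤ m) (hmn : m ≤ n)
    (I : Finset (Fin n)) (hI : I.Nonempty) (D c : ℝ) (hD : 1 ≤ D) (hc : 0 < c)
    (𝒥 : Fin n → Finset (Finset (Fin n)))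
    (h𝒥 : ∀ i ∈ I, ∀ S ∈ 𝒥 i, S.card = m ∧ i ∈ S ∧ ((S ∩ I).card : ℝ) ≤ D)
    (hcard : ∀ i ∈ I, c * ((n - 1).choose (m - 1) : ℝ) ≤ ((𝒥 i).card : ℝ)) :
    (I.card : ℝ) * c * ((n - 1).choose (m - 1) : ℝ) / D ≤
      ((((Finset.univ : Finset (Fin n)).powersetCard m).filter
        (fun S => ∃ i ∈ I, S ∈ 𝒥 i)).card : ℝ) := by
  set U := ((Finset.univ : Finset (Fin n)).powersetCard m).filter
        (fun S => ∃ i ∈ I, S ∈ 𝒥 i) with hU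
  rw [div_le_iff₀ (by linarith)]
  have h1 : (I.card : ℝ) * c * ((n - 1).choose (m - 1) : ℝ) ≤ ∑ i ∈ I, ((𝒥 i).card : ℝ) := by
    have := Finset.sum_le_sum hcard
    rw [Finset.sum_const, nsmul_eq_mul] at this
    linarith
  have h2 : ∑ i ∈ I, (𝒥 i).card = ∑ S ∈ U, (I.filter (fun i => S ∈ 𝒥 i)).card := by
    have h := Finset.sum_card_bipartiteAbove_eq_sum_card_bipartiteBelow
      (s := I) (t := U) (fun i S => S ∈ 𝒥 i)
    unfold Finset.bipartiteAbove Finset.bipartiteBelow at h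
    rw [← h]
    refine Finset.sum_congr rfl fun i hi => ?_
    congr 1
    ext S
    simp only [hU, Finset.mem_filter, Finset.mem_powersetCard]
    exact ⟨fun hS => ⟨⟨⟨Finset.subset_univ _, (h𝒥 i hi S hS).1⟩, i, hi, hS⟩, hS⟩, fun hS => hS.2⟩
  have h3 : ∑ S ∈ U, ((I.filter (fun i => S ∈ 𝒥 i)).card : ℝ) ≤ ∑ S ∈ U, D := by
    refine Finset.sum_le_sum fun S hS => ?_
    obtain ⟨i, hi, hiS⟩ := (Finset.mem_filter.1 hS).2
    refine le_trans ?_ (h𝒥 i hi S hiS).2.2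
    have hsub : I.filter (fun i => S ∈ 𝒥 i) ⊆ S ∩ I := by
      intro j hj
      obtain ⟨hj1, hj2⟩ := Finset.mem_filter.1 hj
      exact Finset.mem_inter.2 ⟨(h𝒥 j hj1 S hj2).2.1, hj1⟩
    exact_mod_cast Finset.card_le_card hsub
  rw [Finset.sum_const, nsmul_eq_mul] at h3
  have h2' : ∑ i ∈ I, ((𝒥 i).card : ℝ) = ∑ S ∈ U, ((I.filter (fun i => S ∈ 𝒥 i)).card : ℝ) := by
    exact_mod_cast h2
  linarith
end

section
/- Let X⁺ and X⁻ be finite nonempty sets, let P and Q be finite nonempty sets, and let E ⊆ P × Q be a biregular relation: every S ∈ P is E-related to exactly m ≥ 1 elements of Q and every T ∈ Q is E-related to exactly k ≥ 1 elements of P. Let G⁺ ⊆ X⁺ × P and G⁻ ⊆ X⁻ × Q be relations such that every x ∈ X⁺ satisfies |{S ∈ P : (x, S) ∈ G⁺}| ≥ (3/4)·|P| and every x ∈ X⁻ satisfies |{T ∈ Q : (x, T) ∈ G⁻}| ≥ (3/4)·|Q|. Call S ∈ P informative if both (i) |{x ∈ X⁺ : (x, S) ∈ G⁺}| ≥ (1/5)·|X⁺|,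 and (ii) at least (1/10)·m of the T ∈ Q with (S, T) ∈ E satisfy |{x ∈ X⁻ : (x, T) ∈ G⁻}| ≥ (1/5)·|X⁻|. Then at least (1/8)·|P| elements of P are informative. -/
open Finset

theorem aux_avg {σ : Type*} (P : Finset σ) (f : σ → ℝ) (D a c : ℝ)
    (hD : ∀ S ∈ P, f S ≤ D) (hc : c ≤ ∑ S ∈ P, f S) :
    c ≤ ((P.filter (fun S => a ≤ f S)).card : ℝ) * D +
      ((P.card : ℝ) - ((P.filter (fun S => a ≤ f S)).card : ℝ)) * a := by
  have h1 := Finset.sum_filter_add_sum_filter_not P (fun S => a ≤ f S) f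
  have h2 : ((P.filter (fun S => a ≤ f S)).card : ℝ) +
      ((P.filter (fun S => ¬ a ≤ f S)).card : ℝ) = P.card := by
    exact_mod_cast Finset.card_filter_add_card_filter_not (s := P) (fun S => a ≤ f S)
  have h3 := Finset.sum_le_card_nsmul (P.filter (fun S => a ≤ f S)) f D
    (fun S hS => hD S (Finset.mem_filter.1 hS).1)
  have h4 := Finset.sum_le_card_nsmul (P.filter (fun S => ¬ a ≤ f S)) f a
    (fun S hS => (not_le.1 (Finset.mem_filter.1 hS).2).le)
  rw [nsmul_eq_mul] at h3 h4
  have h5 : (P.card : ℝ) - ((P.filter (fun S => a ≤ f S)).card : ℝ) =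
    ((P.filter (fun S => ¬ a ≤ f S)).card : ℝ) := by linarith
  rw [h5]
  linarith

theorem aux_dc {γ σ : Type*} (X : Finset γ) (P : Finset σ) (r : γ → σ → Prop)
    [∀ x S, Decidable (r x S)] :
    ∑ S ∈ P, ((X.filter (fun x => r x S)).card : ℝ) =
      ∑ x ∈ X, ((P.filter (fun S => r x S)).card : ℝ) := by
  exact_mod_cast (Finset.sum_card_bipartiteAbove_eq_sum_card_bipartiteBelow (s := X) (t := P) r).symm

theorem aux_good {γ σ : Type*} (X : Finset γ) (P : Finset σ) (r : γ → σ → Prop)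
    [∀ x S, Decidable (r x S)] (hX : X.Nonempty)
    (h : ∀ x ∈ X, (3 / 4 : ℝ) * (P.card : ℝ) ≤ ((P.filter (fun S => r x S)).card : ℝ)) :
    (11 / 16 : ℝ) * P.card ≤ ((P.filter (fun S => (1 / 5 : ℝ) * (X.card : ℝ) ≤
      ((X.filter (fun x => r x S)).card : ℝ))).card : ℝ) := by
  have h1 := Finset.card_nsmul_le_sum X _ _ h
  rw [← aux_dc, nsmul_eq_mul] at h1
  have h2 := aux_avg P _ X.card ((1 / 5 : ℝ) * (X.card : ℝ)) _
    (fun S _ => by exact_mod_cast Finset.card_filter_le _ _) h1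
  have hp : (0 : ℝ) < X.card := by exact_mod_cast hX.card_pos
  refine le_of_mul_le_mul_left ?_ hp
  linarith

/-- Abstract form of Lemma 3.2: with `E ⊆ P × Q` biregular (left-degree `m`,
right-degree `k`), every `x ∈ X⁺` good (w.r.t. `G⁺`) with at least `3/4` of `P`,
and every `x ∈ X⁻` good (w.r.t. `G⁻`) with at least `3/4` of `Q`, at least
`(1/8)·|P|` elements `S ∈ P` are informative: `S` is good for at least a `1/5`
fraction of `X⁺` and at least `(1/10)·m` of its `E`-neighbors `T` are good for at
least a `1/5` fraction of `X⁻`. -/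
theorem informative_fraction {γ δ σ τ : Type*}
    [DecidableEq γ] [DecidableEq δ] [DecidableEq σ] [DecidableEq τ]
    (Xp : Finset γ) (Xm : Finset δ) (P : Finset σ) (Q : Finset τ)
    (hXp : Xp.Nonempty) (hXm : Xm.Nonempty) (hP : P.Nonempty) (hQ : Q.Nonempty)
    (E : Finset (σ × τ)) (hE : E ⊆ P ×ˢ Q) (m k : ℕ) (hm : 1 ≤ m) (hk : 1 ≤ k)
    (hreg1 : ∀ S ∈ P, (Q.filter (fun T => (S, T) ∈ E)).card = m)
    (hreg2 : ∀ T ∈ Q, (P.filter (fun S => (S, T) ∈ E)).card = k)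
    (Gp : Finset (γ × σ)) (hGp : Gp ⊆ Xp ×ˢ P)
    (Gm : Finset (δ × τ)) (hGm : Gm ⊆ Xm ×ˢ Q)
    (hrowp : ∀ x ∈ Xp, (3 / 4 : ℝ) * (P.card : ℝ) ≤
      ((P.filter (fun S => (x, S) ∈ Gp)).card : ℝ))
    (hrowm : ∀ x ∈ Xm, (3 / 4 : ℝ) * (Q.card : ℝ) ≤
      ((Q.filter (fun T => (x, T) ∈ Gm)).card : ℝ)) :
    (1 / 8 : ℝ) * (P.card : ℝ) ≤
      ((P.filter (fun S =>
        (1 / 5 : ℝ) * (Xp.card : ℝ) ≤ ((Xp.filter (fun x => (x, S) ∈ Gp)).card : ℝ) ∧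
        (1 / 10 : ℝ) * (m : ℝ) ≤
          ((Q.filter (fun T => (S, T) ∈ E ∧
            (1 / 5 : ℝ) * (Xm.card : ℝ) ≤
              ((Xm.filter (fun x => (x, T) ∈ Gm)).card : ℝ))).card : ℝ))).card : ℝ) := by
  have g1 := aux_good Xp P (fun x S => (x, S) ∈ Gp) hXp hrowp
  have g2 := aux_good Xm Q (fun x T => (x, T) ∈ Gm) hXm hrowm
  have e1 := aux_dc Q P (fun T S => (S, T) ∈ E)
  rw [Finset.sum_congr rfl (fun S hS => by rw [hreg1 S hS]),
    Finset.sum_congr (s₁ := Q) rfl (fun T hT => by rw [hreg2 T hT])] at e1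
  simp only [Finset.sum_const, nsmul_eq_mul] at e1
  set good : τ → Prop := fun T => (1 / 5 : ℝ) * (Xm.card : ℝ) ≤
    ((Xm.filter (fun x => (x, T) ∈ Gm)).card : ℝ) with hgood
  have e2 := aux_dc (Q.filter good) P (fun T S => (S, T) ∈ E)
  rw [Finset.sum_congr (s₁ := Q.filter good) rfl
    (fun T hT => by rw [hreg2 T (Finset.mem_filter.1 hT).1])] at e2
  simp only [Finset.sum_const, nsmul_eq_mul, Finset.filter_filter] at e2
  simp only [and_comm (a := good _)] at e2
  have g3 := aux_avg P (fun S => ((Q.filter (fun T => (S, T) ∈ E ∧ good T)).card : ℝ)) m ((1 / 10 : ℝ) * (m : ℝ)) _ (fun S hS => by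
    rw [← hreg1 S hS]
    refine Nat.cast_le.2 (Finset.card_le_card fun T hT => ?_)
    rw [Finset.mem_filter] at hT ⊢
    exact ⟨hT.1, hT.2.1⟩) e2.ge
  have hm' : (0 : ℝ) < m := by exact_mod_cast hm
  have hk' : (0 : ℝ) < k := by exact_mod_cast hk
  have g4 := mul_le_mul_of_nonneg_right g2 hk'.le
  have g5 : (47 / 72 : ℝ) * P.card ≤ ((P.filter (fun S => (1 / 10 : ℝ) * (m : ℝ) ≤
      ((Q.filter (fun T => (S, T) ∈ E ∧ good T)).card : ℝ))).card : ℝ) := by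
    refine le_of_mul_le_mul_left ?_ hm'
    linarith
  rw [Finset.filter_and]
  have h6 := Finset.card_union_add_card_inter
    (P.filter (fun S => (1 / 5 : ℝ) * (Xp.card : ℝ) ≤
      ((Xp.filter (fun x => (x, S) ∈ Gp)).card : ℝ)))
    (P.filter (fun S => (1 / 10 : ℝ) * (m : ℝ) ≤
      ((Q.filter (fun T => (S, T) ∈ E ∧ good T)).card : ℝ)))
  have h7 := Finset.card_le_card (Finset.union_subset
    (Finset.filter_subset (fun S => (1 / 5 : ℝ) * (Xp.card : ℝ) ≤
      ((Xp.filter (fun x => (x, S) ∈ Gp)).card : ℝ)) P)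
    (Finset.filter_subset (fun S => (1 / 10 : ℝ) * (m : ℝ) ≤
      ((Q.filter (fun T => (S, T) ∈ E ∧ good T)).card : ℝ)) P))
  have h6' := congrArg (Nat.cast : ℕ → ℝ) h6
  have h7' := (Nat.cast_le (α := ℝ)).2 h7
  push_cast at h6'
  have hp : (0 : ℝ) ≤ P.card := Nat.cast_nonneg _
  linarith
end

section
/- Let n and m be naturals with 1 ≤ m ≤ n, let I ⊆ Fin n, and set μ = m·|I|/n (a nonnegative real). Then the number of m-element subsets S of Fin n with |S ∩ I| ≥ 4μ is at most exp(−μ)·C(n, m). -/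
open Finset

lemma choose_ratio_aux (n m : ℕ) (hmn : m ≤ n) (j : ℕ) (hj : j ≤ m) :
    (n - j).choose (m - j) * n ^ j ≤ n.choose m * m ^ j := by
  induction j with
  | zero => simp
  | succ j ih =>
    have ih := ih (by omega)
    obtain ⟨a, rfl⟩ : ∃ a, m = a + (j + 1) := ⟨m - (j + 1), by omega⟩
    obtain ⟨b, rfl⟩ : ∃ b, n = b + (j + 1) := ⟨n - (j + 1), by omega⟩
    have e1 : a + (j + 1) - j = a + 1 := by omega
    have e2 : b + (j + 1) - j = b + 1 := by omega
    rw [e1, e2] at ih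
    simp only [Nat.add_sub_cancel]
    have h1 := Nat.add_one_mul_choose_eq b a
    have hab : a ≤ b := by omega
    have h2 : (a + 1) * (b + (j + 1)) ≤ (a + (j + 1)) * (b + 1) := by nlinarith
    apply Nat.le_of_mul_le_mul_left _ (Nat.succ_pos b)
    calc (b + 1) * (b.choose a * (b + (j + 1)) ^ (j + 1))
        = ((b + 1) * b.choose a) * (b + (j + 1)) ^ (j + 1) := by ring
      _ = ((b + 1).choose (a + 1) * (b + (j + 1)) ^ j) * ((a + 1) * (b + (j + 1))) := by
          rw [h1]; ring
      _ ≤ ((b + (j + 1)).choose (a + (j + 1)) * (a + (j + 1)) ^ j)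
            * ((a + (j + 1)) * (b + 1)) := Nat.mul_le_mul ih h2
      _ = _ := by rw [Nat.succ_eq_add_one]; ring

lemma count_aux (n m : ℕ) (hmn : m ≤ n) (T : Finset (Fin n)) :
    (((univ : Finset (Fin n)).powersetCard m).filter (fun S => T ⊆ S)).card * n ^ T.card
      ≤ n.choose m * m ^ T.card := by
  by_cases hj : T.card ≤ m
  · refine le_trans (Nat.mul_le_mul_right _ ?_) (choose_ratio_aux n m hmn _ hj)
    have hc : ((univ \ T).powersetCard (m - T.card)).card
        = (n - T.card).choose (m - T.card) := by
      rw [card_powersetCard, card_sdiff_of_subset (subset_univ _), card_univ, Fintype.card_fin]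
    rw [← hc]
    apply card_le_card_of_injOn (fun S => S \ T)
    · intro S hS
      simp only [coe_filter, mem_powersetCard, Set.mem_setOf_eq] at hS
      simp only [mem_coe, mem_powersetCard]
      exact ⟨sdiff_subset_sdiff (subset_univ _) le_rfl, by
        rw [card_sdiff_of_subset hS.2, hS.1.2]⟩
    · intro S hS S' hS' h
      simp only [coe_filter, mem_powersetCard, Set.mem_setOf_eq] at hS hS'
      simp only at h
      rw [← sdiff_union_of_subset hS.2, h, sdiff_union_of_subset hS'.2]
  · have : ((univ : Finset (Fin n)).powersetCard m).filter (fun S => T ⊆ S) = ∅ := by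
      apply filter_eq_empty_iff.2
      intro S hS hT
      have := card_le_card hT
      rw [(mem_powersetCard.1 hS).2] at this
      exact hj this
    simp [this]

lemma mgf_aux (n m : ℕ) (hm : 1 ≤ m) (hmn : m ≤ n) (I : Finset (Fin n)) (y : ℝ) (hy : 0 ≤ y) :
    ∑ S ∈ (univ : Finset (Fin n)).powersetCard m, (y + 1) ^ (S ∩ I).card
      ≤ (n.choose m : ℝ) * (y * (m / n) + 1) ^ I.card := by
  have hn : (0 : ℝ) < n := by exact_mod_cast (by omega : 0 < n)
  have key : ∀ (z : ℝ) (A : Finset (Fin n)), (z + 1) ^ A.card = ∑ T ∈ A.powerset, z ^ T.card := by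
    intro z A
    rw [← Finset.sum_pow_mul_eq_add_pow z 1 A]
    simp
  have h1 : ∀ S : Finset (Fin n), (y + 1) ^ (S ∩ I).card
      = ∑ T ∈ I.powerset, if T ⊆ S then y ^ T.card else 0 := by
    intro S
    rw [key, ← sum_filter]
    congr 1
    ext T
    simp only [mem_powerset, mem_filter, subset_inter_iff]
    tauto
  rw [sum_congr rfl (fun S _ => h1 S), sum_comm, key, mul_sum]
  apply sum_le_sum
  intro T _
  rw [← sum_filter, sum_const, nsmul_eq_mul, mul_pow, div_pow]
  have h := count_aux n m hmn T
  have h' : ((((univ : Finset (Fin n)).powersetCard m).filter (fun S => T ⊆ S)).card : ℝ)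
      * (n : ℝ) ^ T.card ≤ (n.choose m : ℝ) * (m : ℝ) ^ T.card := by exact_mod_cast h
  rw [← le_div_iff₀ (by positivity)] at h'
  calc _ ≤ (n.choose m : ℝ) * (m : ℝ) ^ T.card / (n : ℝ) ^ T.card * y ^ T.card :=
        mul_le_mul_of_nonneg_right h' (by positivity)
    _ = _ := by ring

/-- Chernoff-type tail bound for the hypergeometric distribution: the number of
`m`-element subsets `S` of `Fin n` with `|S ∩ I| ≥ 4μ`, where `μ = m·|I|/n`, is at
most `exp(−μ)·C(n, m)`. -/
theorem hypergeometric_tail (n m : ℕ) (hm : 1 ≤ m) (hmn : m ≤ n) (I : Finset (Fin n)) :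
    ((((Finset.univ : Finset (Fin n)).powersetCard m).filter
        (fun S => 4 * ((m : ℝ) * (I.card : ℝ) / (n : ℝ)) ≤ ((S ∩ I).card : ℝ))).card : ℝ)
      ≤ Real.exp (-((m : ℝ) * (I.card : ℝ) / (n : ℝ))) * (n.choose m : ℝ) := by
  set μ : ℝ := (m : ℝ) * (I.card : ℝ) / (n : ℝ) with hμ
  have hμ0 : 0 ≤ μ := by positivity
  have he : Real.exp 1 ≤ 4 := by linarith [Real.exp_one_lt_d9]
  have hy : 0 ≤ Real.exp 1 - 1 := by linarith [Real.add_one_le_exp (1 : ℝ)]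
  have h1 := mgf_aux n m hm hmn I (Real.exp 1 - 1) hy
  have h2 : ((Real.exp 1 - 1) * ((m : ℝ) / n) + 1) ^ I.card ≤ Real.exp (3 * μ) := by
    calc _ ≤ (Real.exp ((Real.exp 1 - 1) * ((m : ℝ) / n))) ^ I.card :=
          pow_le_pow_left₀ (by positivity) (Real.add_one_le_exp _) _
      _ = Real.exp ((Real.exp 1 - 1) * μ) := by
          rw [← Real.exp_nat_mul]; congr 1; rw [hμ]; ring
      _ ≤ _ := Real.exp_le_exp.2 (mul_le_mul_of_nonneg_right (by linarith) hμ0)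
  set F := ((Finset.univ : Finset (Fin n)).powersetCard m).filter
        (fun S => 4 * μ ≤ ((S ∩ I).card : ℝ)) with hF
  have h3 : (F.card : ℝ) * Real.exp (4 * μ) ≤
      ∑ S ∈ (univ : Finset (Fin n)).powersetCard m, (Real.exp 1 - 1 + 1) ^ (S ∩ I).card := by
    rw [← nsmul_eq_mul, ← sum_const]
    refine le_trans (sum_le_sum ?_) (sum_le_sum_of_subset_of_nonneg (filter_subset _ _) ?_)
    · intro S hS
      rw [sub_add_cancel, ← Real.exp_nat_mul, mul_one]
      exact Real.exp_le_exp.2 (mem_filter.1 hS).2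
    · intro S _ _
      positivity
  have h4 : (F.card : ℝ) * Real.exp (4 * μ) ≤ (n.choose m : ℝ) * Real.exp (3 * μ) :=
    h3.trans (h1.trans (mul_le_mul_of_nonneg_left h2 (by positivity)))
  rw [← le_div_iff₀ (Real.exp_pos _)] at h4
  refine h4.trans (le_of_eq ?_)
  rw [mul_div_assoc, ← Real.exp_sub, mul_comm]
  congr 2
  ring
end
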